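/- If every vertex of a graph G has degree at least 3, then every vertex of the line graph L(G) has degree at least 4, the least signless Laplacian eigenvalue of L(G) is at least 2, and consequently every negative adjacency eigenvalue of L(L(G)) equals −2. -/

import Mathlib

open scoped Classical

/-- The signless Laplacian matrix `Q = D + A` of a graph. -/
noncomputable def qMatrix {V : Type*} [Fintype V] (G : SimpleGraph V) : Matrix V V ℝ :=
  Matrix.diagonal (fun v => (G.degree v : ℝ)) + G.adjMatrix ℝ

namespace LG3
open Matrix

variable {W : Type*} [Fintype W]

noncomputable def inc (H : SimpleGraph W) : Matrix W H.edgeSet ℝ :=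
  fun v e => if v ∈ e.1 then 1 else 0

lemma inc_mul_transpose (H : SimpleGraph W) : inc H * (inc H)ᵀ = qMatrix H := by
  have key : inc H * (inc H)ᵀ = H.incMatrix ℝ * (H.incMatrix ℝ)ᵀ := by
    ext a b
    simp only [Matrix.mul_apply, Matrix.transpose_apply]
    refine Fintype.sum_of_injective (fun e : H.edgeSet => e.1) Subtype.val_injective _ _ ?_ ?_
    · intro e he
      have : e ∉ H.edgeSet := by simpa using he
      simp [SimpleGraph.incMatrix_apply', SimpleGraph.incidenceSet, this]
    · rintro ⟨e, he⟩
      simp [SimpleGraph.incMatrix_apply', SimpleGraph.incidenceSet, he, inc]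
  rw [key, SimpleGraph.incMatrix_mul_transpose]
  ext a b
  by_cases h : a = b
  · subst h
    simp [qMatrix]
  · simp [qMatrix, h, SimpleGraph.adjMatrix_apply]

lemma sum_mem_edge (H : SimpleGraph W) {a b : W} (hab : a ≠ b) (g : W → ℝ) :
    ∑ v, (if v ∈ s(a, b) then (1 : ℝ) else 0) * g v = g a + g b := by
  have : ∀ v, (if v ∈ s(a, b) then (1 : ℝ) else 0) * g v
      = (if v = a then g v else 0) + (if v = b then g v else 0) := by
    intro v
    simp only [Sym2.mem_iff]
    grind
  simp only [this, Finset.sum_add_distrib, Finset.sum_ite_eq', Finset.sum_ite_eq,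
    Finset.mem_univ, if_true]

lemma transpose_mul_inc (H : SimpleGraph W) :
    (inc H)ᵀ * inc H = (2 : ℝ) • (1 : Matrix H.edgeSet H.edgeSet ℝ) + H.lineGraph.adjMatrix ℝ := by
  ext ⟨e, he⟩ ⟨f, hf⟩
  induction e with | _ a b
  induction f with | _ c d
  have hab : a ≠ b := H.ne_of_adj he
  have hcd : c ≠ d := H.ne_of_adj hf
  simp only [Matrix.mul_apply, Matrix.transpose_apply, inc]
  rw [sum_mem_edge H hab]
  have hadj : H.lineGraph.Adj ⟨s(a, b), he⟩ ⟨s(c, d), hf⟩ ↔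
      (s(a, b) ≠ s(c, d) ∧ (a = c ∨ a = d ∨ b = c ∨ b = d)) := by
    simp only [SimpleGraph.lineGraph_adj_iff_exists]
    simp
    grind
  simp only [Matrix.add_apply, Matrix.smul_apply, Matrix.one_apply, SimpleGraph.adjMatrix_apply,
    hadj, Subtype.mk.injEq, Sym2.mem_iff, Sym2.eq_iff, ne_eq, smul_eq_mul]
  grind

lemma sum_inc (H : SimpleGraph W) (v : W) : ∑ e, inc H v e = H.degree v := by
  have h := congrFun (congrFun (inc_mul_transpose H) v) v
  simp only [Matrix.mul_apply, Matrix.transpose_apply, qMatrix, Matrix.add_apply,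
    Matrix.diagonal_apply_eq, SimpleGraph.adjMatrix_apply, SimpleGraph.irrefl, if_false,
    add_zero] at h
  rw [← h]
  refine Finset.sum_congr rfl fun e _ => ?_
  simp [inc]

lemma degree_line (H : SimpleGraph W) (hδ : ∀ v, 3 ≤ H.degree v) (e : H.edgeSet) :
    4 ≤ H.lineGraph.degree e := by
  have h : ∑ f, ((inc H)ᵀ * inc H) e f = 2 + (H.lineGraph.degree e : ℝ) := by
    rw [transpose_mul_inc]
    simp [Finset.sum_add_distrib, Matrix.one_apply, SimpleGraph.adjMatrix_apply,
      ← SimpleGraph.card_neighborFinset_eq_degree, SimpleGraph.neighborFinset_eq_filter]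
  simp only [Matrix.mul_apply, Matrix.transpose_apply] at h
  rw [Finset.sum_comm] at h
  simp only [← Finset.mul_sum, sum_inc] at h
  obtain ⟨e, he⟩ := e
  induction e with | _ a b
  simp only [inc] at h
  rw [sum_mem_edge H (H.ne_of_adj he)] at h
  have h2 : H.degree a + H.degree b = 2 + H.lineGraph.degree ⟨s(a, b), he⟩ := by exact_mod_cast h
  have := hδ a
  have := hδ b
  omega

lemma exists_eigvec {M : Matrix W W ℝ} {μ : ℝ} (h : μ ∈ M.charpoly.roots) :
    ∃ x, x ≠ 0 ∧ M *ᵥ x = μ • x := by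
  have h1 := (Polynomial.mem_roots'.1 h).2
  rw [Polynomial.IsRoot, Matrix.eval_charpoly] at h1
  obtain ⟨x, hx, h2⟩ := Matrix.exists_mulVec_eq_zero_iff.2 h1
  refine ⟨x, hx, ?_⟩
  rw [Matrix.sub_mulVec, sub_eq_zero] at h2
  rw [← h2]
  simp

lemma q_ge (H : SimpleGraph W) (hδ : ∀ e, 4 ≤ H.lineGraph.degree e) {q : ℝ} {x : H.edgeSet → ℝ}
    (hx : x ≠ 0) (h : qMatrix H.lineGraph *ᵥ x = q • x) : 2 ≤ q := by
  have hA : H.lineGraph.adjMatrix ℝ = (inc H)ᵀ * inc H - (2 : ℝ) • 1 := by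
    rw [transpose_mul_inc]; abel
  have hpos : 0 < x ⬝ᵥ x := by
    have : 0 ≤ x ⬝ᵥ x := Finset.sum_nonneg fun i _ => mul_self_nonneg _
    exact lt_of_le_of_ne this fun h => hx (dotProduct_self_eq_zero.1 h.symm)
  have h1 : x ⬝ᵥ (qMatrix H.lineGraph *ᵥ x) = q * (x ⬝ᵥ x) := by
    rw [h, dotProduct_smul, smul_eq_mul]
  rw [qMatrix, hA, add_mulVec, sub_mulVec, dotProduct_add, dotProduct_sub, ← mulVec_mulVec,
    dotProduct_mulVec x (inc H)ᵀ, vecMul_transpose, smul_mulVec, one_mulVec, dotProduct_smul,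
    smul_eq_mul] at h1
  have h2 : 0 ≤ (inc H *ᵥ x) ⬝ᵥ (inc H *ᵥ x) := Finset.sum_nonneg fun i _ => mul_self_nonneg _
  have h3 : 4 * (x ⬝ᵥ x) ≤
      q * (x ⬝ᵥ x) - ((inc H *ᵥ x) ⬝ᵥ (inc H *ᵥ x) - 2 * (x ⬝ᵥ x)) := by
    rw [← h1, add_sub_cancel_right]
    simp only [dotProduct, mulVec_diagonal, Finset.mul_sum]
    refine Finset.sum_le_sum fun i _ => ?_
    have h4 : (4 : ℝ) ≤ H.lineGraph.degree i := by exact_mod_cast hδ i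
    have h5 := mul_le_mul_of_nonneg_right h4 (mul_self_nonneg (x i))
    refine h5.trans (le_of_eq ?_)
    rw [mul_left_comm]
  by_contra hq
  push Not at hq
  have h6 := mul_lt_mul_of_pos_right hq hpos
  linarith

lemma line_eig (H : SimpleGraph W) {μ : ℝ} {x : H.edgeSet → ℝ} (hx : x ≠ 0)
    (h : H.lineGraph.adjMatrix ℝ *ᵥ x = μ • x) (hμ : μ ≠ -2) :
    ∃ y, y ≠ 0 ∧ qMatrix H *ᵥ y = (μ + 2) • y := by
  have h1 : (inc H)ᵀ *ᵥ (inc H *ᵥ x) = (μ + 2) • x := by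
    rw [mulVec_mulVec, transpose_mul_inc, add_mulVec, h, smul_mulVec, one_mulVec, add_smul,
      add_comm]
  refine ⟨inc H *ᵥ x, fun h0 => ?_, ?_⟩
  · rw [h0, mulVec_zero] at h1
    rcases smul_eq_zero.1 h1.symm with h2 | h2
    · exact hμ (by linarith)
    · exact hx h2
  · rw [← inc_mul_transpose, ← mulVec_mulVec, h1, mulVec_smul]

end LG3

theorem minDegree_three_lineGraph {V : Type*} [Fintype V] [DecidableEq V]
    (G : SimpleGraph V) [DecidableRel G.Adj]
    (hδ : ∀ v, 3 ≤ G.degree v) :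
    (∀ e : G.edgeSet, 4 ≤ (G.lineGraph).degree e) ∧
      (∀ q ∈ (qMatrix G.lineGraph).charpoly.roots, (2 : ℝ) ≤ q) ∧
      (∀ μ ∈ ((G.lineGraph.lineGraph).adjMatrix ℝ).charpoly.roots, μ < 0 → μ = -2) := by
  have h1 : ∀ e : G.edgeSet, 4 ≤ (G.lineGraph).degree e := by
    intro e
    convert LG3.degree_line G (fun v => by convert hδ v) e
  refine ⟨h1, ?_, ?_⟩
  · intro q hq
    obtain ⟨x, hx, h⟩ := LG3.exists_eigvec (by convert hq)
    refine LG3.q_ge G (fun e => by convert h1 e) hx ?_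
    convert h
  · intro μ hμ hneg
    by_contra hne
    obtain ⟨x, hx, h⟩ := LG3.exists_eigvec (by convert hμ)
    obtain ⟨y, hy, h2⟩ := LG3.line_eig G.lineGraph (μ := μ) hx (by convert h) hne
    have := LG3.q_ge G (q := μ + 2) (fun e => by convert h1 e) hy (by convert h2)
    linarith
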